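/- Let α > 0, ℓ ≥ 1, 0 < δ < 1, and let n = 2^{ℓ−1}. Consider the hierarchical mechanism over the complete binary tree of height ℓ: the true count of each node receives independent Laplace(ℓ/α) noise, and each of the at most n·(n+1)/2 range queries [x,y] is answered by summing the noisy counts of at most 2ℓ disjoint subtree roots covering the range. Then with probability at least 1 − δ, simultaneously for every range query q, the absolute error |H̃_q(I) − H_q(I)| is at most 16·ℓ^{3/2}·ln(2n²/δ)/α. In particular, the mechanism is (ε, δ)-useful for the class of range queries on a database of N records whenever N ≥ 16·ℓ^{3/2}·ln(2n²/δ)/(α·ε). -/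

import Mathlib

open MeasureTheory

/-- A node of the complete binary tree (`k = 2`) with `ℓ` levels of nodes. -/
abbrev TreeNode (k ℓ : ℕ) : Type := Σ d : Fin ℓ, Fin (k ^ (d : ℕ))

/-- The contiguous interval of leaves covered by node `v`. -/
def subtreeLeaves {k ℓ : ℕ} (v : TreeNode k ℓ) : Finset (Fin (k ^ (ℓ - 1))) :=
  Finset.univ.filter fun u => (u : ℕ) / k ^ (ℓ - 1 - (v.1 : ℕ)) = (v.2 : ℕ)

/-- The Laplace measure on `ℝ` with scale `b`: density `x ↦ (1/(2b))·exp(−|x|/b)`. -/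
noncomputable def laplaceMeasure (b : ℝ) : Measure ℝ :=
  volume.withDensity fun x => ENNReal.ofReal ((2 * b)⁻¹ * Real.exp (-|x| / b))

/-- I.i.d. Laplace noise with scale `b`, one coordinate per node of the binary tree. -/
noncomputable def treeNoise (k ℓ : ℕ) (b : ℝ) : Measure (TreeNode k ℓ → ℝ) :=
  Measure.pi fun _ => laplaceMeasure b


open ProbabilityTheory

section Laplace

variable {b t : ℝ}

theorem integrableOn_laplace_mul_exp_Ioi (hb : 0 < b) (ht : t * b < 1) :
    IntegrableOn (fun x => (2 * b)⁻¹ * Real.exp (-|x| / b) * Real.exp (t * x)) (Set.Ioi 0) ∧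
      ∫ x in Set.Ioi 0, (2 * b)⁻¹ * Real.exp (-|x| / b) * Real.exp (t * x) =
        (2 * (1 - t * b))⁻¹ := by
  have ha : t - b⁻¹ < 0 := by
    rw [sub_neg, ← one_div, lt_div_iff₀ hb]
    exact ht
  have hEq : Set.EqOn (fun x => (2 * b)⁻¹ * Real.exp ((t - b⁻¹) * x))
      (fun x => (2 * b)⁻¹ * Real.exp (-|x| / b) * Real.exp (t * x)) (Set.Ioi 0) := by
    intro x hx
    simp only [abs_of_pos (Set.mem_Ioi.1 hx), mul_assoc, ← Real.exp_add]
    congr 2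
    ring
  refine ⟨IntegrableOn.congr_fun ((integrableOn_exp_mul_Ioi ha 0).const_mul _) hEq
    measurableSet_Ioi, ?_⟩
  rw [← setIntegral_congr_fun measurableSet_Ioi hEq, integral_const_mul,
    integral_exp_mul_Ioi ha]
  have h1 : 1 - t * b ≠ 0 := by linarith
  have h3 : t - b⁻¹ = -((1 - t * b) / b) := by
    field_simp
    ring
  rw [h3, mul_zero, Real.exp_zero]
  field_simp

theorem integrableOn_laplace_mul_exp_Iic (hb : 0 < b) (ht : -1 < t * b) :
    IntegrableOn (fun x => (2 * b)⁻¹ * Real.exp (-|x| / b) * Real.exp (t * x)) (Set.Iic 0) ∧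
      ∫ x in Set.Iic 0, (2 * b)⁻¹ * Real.exp (-|x| / b) * Real.exp (t * x) =
        (2 * (1 + t * b))⁻¹ := by
  have h3 : t + b⁻¹ = (1 + t * b) / b := by
    field_simp
    ring
  have ha : 0 < t + b⁻¹ := h3 ▸ div_pos (by linarith) hb
  have hEq : Set.EqOn (fun x => (2 * b)⁻¹ * Real.exp ((t + b⁻¹) * x))
      (fun x => (2 * b)⁻¹ * Real.exp (-|x| / b) * Real.exp (t * x)) (Set.Iic 0) := by
    intro x hx
    simp only [abs_of_nonpos (Set.mem_Iic.1 hx), mul_assoc, ← Real.exp_add]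
    congr 2
    ring
  refine ⟨IntegrableOn.congr_fun ((integrableOn_exp_mul_Iic ha 0).const_mul _) hEq
    measurableSet_Iic, ?_⟩
  rw [← setIntegral_congr_fun measurableSet_Iic hEq, integral_const_mul,
    integral_exp_mul_Iic ha, h3, mul_zero, Real.exp_zero]
  have h1 : 1 + t * b ≠ 0 := by linarith
  field_simp

theorem integrable_laplace_mul_exp (hb : 0 < b) (ht : |t * b| < 1) :
    Integrable (fun x => (2 * b)⁻¹ * Real.exp (-|x| / b) * Real.exp (t * x)) ∧
      ∫ x, (2 * b)⁻¹ * Real.exp (-|x| / b) * Real.exp (t * x) = (1 - (t * b) ^ 2)⁻¹ := by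
  obtain ⟨ht1, ht2⟩ := abs_lt.1 ht
  obtain ⟨hi1, hv1⟩ := integrableOn_laplace_mul_exp_Ioi hb ht2
  obtain ⟨hi2, hv2⟩ := integrableOn_laplace_mul_exp_Iic hb ht1
  refine ⟨?_, ?_⟩
  · rw [← integrableOn_univ, ← Set.Iic_union_Ioi (a := (0 : ℝ))]
    exact hi2.union hi1
  · rw [← intervalIntegral.integral_Iic_add_Ioi hi2 hi1, hv1, hv2]
    have h1 : 1 - t * b ≠ 0 := by linarith
    have h2 : 1 + t * b ≠ 0 := by linarith
    have h3 : 1 - (t * b) ^ 2 = (1 - t * b) * (1 + t * b) := by ring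
    rw [h3]
    field_simp
    ring

theorem isProbabilityMeasure_laplaceMeasure (hb : 0 < b) :
    IsProbabilityMeasure (laplaceMeasure b) := by
  obtain ⟨hi, hv⟩ := integrable_laplace_mul_exp (b := b) (t := 0) hb (by simp)
  simp only [zero_mul, Real.exp_zero, mul_one] at hi hv
  refine ⟨?_⟩
  rw [laplaceMeasure, withDensity_apply _ MeasurableSet.univ, Measure.restrict_univ,
    ← ofReal_integral_eq_lintegral_ofReal hi (Filter.Eventually.of_forall fun x => by positivity),
    hv]
  simp

theorem integrable_exp_mul_laplaceMeasure (hb : 0 < b) (ht : |t * b| < 1) :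
    Integrable (fun x => Real.exp (t * x)) (laplaceMeasure b) := by
  rw [laplaceMeasure, integrable_withDensity_iff_integrable_smul' (by fun_prop) (by simp)]
  refine (integrable_laplace_mul_exp hb ht).1.congr (Filter.Eventually.of_forall fun x => ?_)
  simp only [smul_eq_mul]
  rw [ENNReal.toReal_ofReal (by positivity)]

theorem mgf_laplaceMeasure (hb : 0 < b) (ht : |t * b| < 1) :
    mgf id (laplaceMeasure b) t = (1 - (t * b) ^ 2)⁻¹ := by
  rw [mgf, laplaceMeasure, integral_withDensity_eq_integral_toReal_smul (by fun_prop) (by simp),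
    ← (integrable_laplace_mul_exp hb ht).2]
  congr 1 with x
  simp only [smul_eq_mul, id]
  rw [ENNReal.toReal_ofReal (by positivity)]

variable {ι : Type*} [Fintype ι]

/-- Chernoff bound for sums of independent Laplace variables. -/
theorem measureReal_pi_laplaceMeasure_sum_ge (hb : 0 < b) (ht0 : 0 ≤ t) (ht : t * b < 1)
    (C : Finset ι) (T : ℝ) :
    (Measure.pi fun _ : ι => laplaceMeasure b).real {ω | T ≤ |∑ v ∈ C, ω v|} ≤
      2 * (Real.exp (-t * T) * (1 - (t * b) ^ 2)⁻¹ ^ C.card) := by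
  have := isProbabilityMeasure_laplaceMeasure hb
  set μ := Measure.pi fun _ : ι => laplaceMeasure b with hμ
  have hat : |t * b| < 1 := by rwa [abs_of_nonneg (by positivity)]
  have hans : |-t * b| < 1 := by rwa [neg_mul, abs_neg]
  have hind : iIndepFun (fun (i : ι) (ω : ι → ℝ) => ω i) μ :=
    iIndepFun_pi (X := fun _ => id) fun _ => aemeasurable_id
  have hint : ∀ s : ℝ, |s * b| < 1 →
      Integrable (fun ω : ι → ℝ => Real.exp (s * (∑ v ∈ C, fun ω : ι → ℝ => ω v) ω)) μ := by
    intro s hs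
    refine hind.integrable_exp_mul_sum (fun i => measurable_pi_apply i) fun i _ => ?_
    exact (measurePreserving_eval (fun _ : ι => laplaceMeasure b) i).integrable_comp_of_integrable
      (integrable_exp_mul_laplaceMeasure hb hs)
  have hmgf : ∀ s : ℝ, |s * b| < 1 →
      mgf (∑ v ∈ C, fun ω : ι → ℝ => ω v) μ s = (1 - (s * b) ^ 2)⁻¹ ^ C.card := by
    intro s hs
    rw [hind.mgf_sum fun i => measurable_pi_apply i, ← mgf_laplaceMeasure hb hs]
    refine Finset.prod_eq_pow_card fun i _ => ?_
    have h := (measurePreserving_eval (fun _ : ι => laplaceMeasure b) i).map_eq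
    rw [← h, mgf_id_map (measurable_pi_apply i).aemeasurable]
  have hge := measure_ge_le_exp_mul_mgf T ht0 (hint t hat)
  have hle := measure_le_le_exp_mul_mgf (-T) (neg_nonpos.2 ht0) (hint (-t) hans)
  rw [hmgf t hat] at hge
  rw [hmgf (-t) hans] at hle
  rw [neg_neg, mul_neg, ← neg_mul, neg_mul t b, neg_sq] at hle
  have hsub : {ω : ι → ℝ | T ≤ |∑ v ∈ C, ω v|} ⊆
      {ω | T ≤ (∑ v ∈ C, fun ω : ι → ℝ => ω v) ω} ∪
        {ω | (∑ v ∈ C, fun ω : ι → ℝ => ω v) ω ≤ -T} := by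
    intro ω hω
    simp only [Set.mem_union, Set.mem_ofPred_eq, Finset.sum_apply] at hω ⊢
    rcases le_abs.1 hω with h | h
    · exact Or.inl h
    · exact Or.inr (by linarith)
  calc _ ≤ _ := measureReal_mono hsub
    _ ≤ _ := measureReal_union_le _ _
    _ ≤ _ := by linarith

end Laplace

section BinaryWeight

/-- `2` to the number of ones in the binary expansion of `x`. -/
def binaryWeight (x : ℕ) : ℕ := 2 ^ (Nat.digits 2 x).sum

theorem one_le_binaryWeight (x : ℕ) : 1 ≤ binaryWeight x := Nat.one_le_two_pow

theorem binaryWeight_two_mul (x : ℕ) : binaryWeight (2 * x) = binaryWeight x := by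
  rcases Nat.eq_zero_or_pos x with rfl | hx
  · simp
  · have h := Nat.digits_add 2 one_lt_two 0 x two_pos (Or.inr hx.ne')
    rw [zero_add] at h
    simp [binaryWeight, h]

theorem binaryWeight_two_mul_add_one (x : ℕ) :
    binaryWeight (2 * x + 1) = 2 * binaryWeight x := by
  have h := Nat.digits_add 2 one_lt_two 1 x one_lt_two (Or.inl one_ne_zero)
  rw [binaryWeight, add_comm, h, List.sum_cons, pow_add, pow_one, binaryWeight]

theorem binaryWeight_le (x : ℕ) : binaryWeight x ≤ x + 1 := by
  induction x using Nat.strong_induction_on with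
  | _ x ih =>
    rcases Nat.even_or_odd' x with ⟨z, rfl | rfl⟩
    · rw [binaryWeight_two_mul]
      rcases Nat.eq_zero_or_pos z with rfl | hz
      · simp [binaryWeight]
      · have := ih z (by omega)
        omega
    · rw [binaryWeight_two_mul_add_one]
      have := ih z (by omega)
      omega

theorem sum_binaryWeight_add_two_pow_le (y k : ℕ) :
    ∑ j ∈ Finset.range k with 2 ^ j ∣ y + 1, binaryWeight (y + 2 ^ j) + binaryWeight (y + 1) ≤
      4 * binaryWeight y := by
  simp only [Finset.sum_filter]
  induction y using Nat.strong_induction_on generalizing k with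
  | _ y ih =>
    rcases Nat.even_or_odd' y with ⟨z, rfl | rfl⟩
    · have hsum : ∑ j ∈ Finset.range k,
          (if 2 ^ j ∣ 2 * z + 1 then binaryWeight (2 * z + 2 ^ j) else 0) ≤
          binaryWeight (2 * z + 1) := by
        cases k with
        | zero => simp
        | succ k =>
          rw [Finset.sum_range_succ', Finset.sum_eq_zero]
          · simp
          · intro j _
            rw [if_neg]
            intro h
            have : 2 ∣ 2 * z + 1 := (dvd_pow_self 2 j.succ_ne_zero).trans h
            omega
      rw [binaryWeight_two_mul_add_one] at *
      rw [binaryWeight_two_mul]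
      omega
    · have hz : 2 * z + 1 + 1 = 2 * (z + 1) := by ring
      rw [hz, binaryWeight_two_mul, binaryWeight_two_mul_add_one]
      cases k with
      | zero =>
        have := ih z (by omega) 0
        simp only [Finset.range_zero, Finset.sum_empty] at this ⊢
        omega
      | succ k =>
        have h := ih z (by omega) k
        have hterm : ∀ j, (if 2 ^ (j + 1) ∣ 2 * (z + 1) then
            binaryWeight (2 * z + 1 + 2 ^ (j + 1)) else 0) =
            2 * (if 2 ^ j ∣ z + 1 then binaryWeight (z + 2 ^ j) else 0) := by
          intro j
          have hw : 2 * z + 1 + 2 ^ (j + 1) = 2 * (z + 2 ^ j) + 1 := by ring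
          rw [hw, binaryWeight_two_mul_add_one, mul_ite, mul_zero]
          simp only [pow_succ', Nat.mul_dvd_mul_iff_left two_pos]
        rw [Finset.sum_range_succ', Finset.sum_congr rfl fun j _ => hterm j, ← Finset.mul_sum]
        simp only [pow_zero, one_dvd, if_true, hz, binaryWeight_two_mul]
        omega

end BinaryWeight

section Covers

variable {ℓ : ℕ}

/-- The number of leaves of the subtree rooted at `v`. -/
def subtreeSize (v : TreeNode 2 ℓ) : ℕ := 2 ^ (ℓ - 1 - (v.1 : ℕ))

/-- The leftmost leaf of the subtree rooted at `v`. -/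
def subtreeStart (v : TreeNode 2 ℓ) : ℕ := v.2 * subtreeSize v

theorem subtreeSize_pos (v : TreeNode 2 ℓ) : 0 < subtreeSize v := Nat.two_pow_pos _

theorem mem_subtreeLeaves {v : TreeNode 2 ℓ} {u : Fin (2 ^ (ℓ - 1))} :
    u ∈ subtreeLeaves v ↔ subtreeStart v ≤ u ∧ (u : ℕ) < subtreeStart v + subtreeSize v := by
  have h := subtreeSize_pos v
  simp only [subtreeLeaves, Finset.mem_filter, Finset.mem_univ, true_and]
  change (u : ℕ) / subtreeSize v = _ ↔ _
  rw [Nat.div_eq_iff h, subtreeStart]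
  omega

theorem subtreeStart_lt (v : TreeNode 2 ℓ) : subtreeStart v < 2 ^ (ℓ - 1) := by
  have hd : (v.1 : ℕ) ≤ ℓ - 1 := by have := v.1.2; omega
  calc subtreeStart v < 2 ^ (v.1 : ℕ) * subtreeSize v :=
        Nat.mul_lt_mul_of_pos_right v.2.2 (subtreeSize_pos v)
    _ = 2 ^ (ℓ - 1) := by rw [subtreeSize, ← pow_add, Nat.add_sub_cancel' hd]

/-- The subtrees rooted at `C` are disjoint and cover an interval of leaves that starts at `x`. -/
def IsCoverFrom (x : ℕ) (C : Finset (TreeNode 2 ℓ)) : Prop :=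
  (∀ v ∈ C, ∀ w ∈ C, v ≠ w → Disjoint (subtreeLeaves v) (subtreeLeaves w)) ∧
    ∃ y : ℕ, ∀ u : Fin (2 ^ (ℓ - 1)), (∃ v ∈ C, u ∈ subtreeLeaves v) ↔ x ≤ u ∧ (u : ℕ) < y

theorem IsCoverFrom.exists_erase {x : ℕ} {C : Finset (TreeNode 2 ℓ)} (hC : IsCoverFrom x C)
    (hne : C.Nonempty) :
    ∃ v ∈ C, subtreeStart v = x ∧ IsCoverFrom (x + subtreeSize v) (C.erase v) := by
  obtain ⟨hdisj, y, hy⟩ := hC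
  obtain ⟨w, hw⟩ := hne
  have hle : ∀ v ∈ C, x ≤ subtreeStart v ∧ subtreeStart v < y := fun v hv =>
    (hy ⟨subtreeStart v, subtreeStart_lt v⟩).1
      ⟨v, hv, mem_subtreeLeaves.2 ⟨le_rfl, Nat.lt_add_of_pos_right (subtreeSize_pos v)⟩⟩
  have hxw := hle w hw
  have hx : x < 2 ^ (ℓ - 1) := hxw.1.trans_lt (subtreeStart_lt w)
  obtain ⟨v, hv, hxv⟩ := (hy ⟨x, hx⟩).2 ⟨le_rfl, hxw.1.trans_lt hxw.2⟩
  have hstart : subtreeStart v = x := le_antisymm (mem_subtreeLeaves.1 hxv).1 (hle v hv).1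
  refine ⟨v, hv, hstart, fun a ha c hc => hdisj a (Finset.mem_of_mem_erase ha) c
    (Finset.mem_of_mem_erase hc), y, fun u => ⟨?_, ?_⟩⟩
  · rintro ⟨a, ha, hua⟩
    have hnot : u ∉ subtreeLeaves v := Finset.disjoint_left.1
      (hdisj a (Finset.mem_of_mem_erase ha) v hv (Finset.ne_of_mem_erase ha)) hua
    have := (hy u).1 ⟨a, Finset.mem_of_mem_erase ha, hua⟩
    rw [mem_subtreeLeaves, hstart] at hnot
    omega
  · rintro ⟨h1, h2⟩
    obtain ⟨a, ha, hua⟩ := (hy u).2 ⟨by omega, h2⟩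
    refine ⟨a, Finset.mem_erase.2 ⟨?_, ha⟩, hua⟩
    rintro rfl
    rw [mem_subtreeLeaves, hstart] at hua
    omega

open Classical in
theorem card_coversFrom_le (x m : ℕ) :
    (Finset.univ.filter fun C : Finset (TreeNode 2 ℓ) => IsCoverFrom x C ∧ C.card ≤ m).card ≤
      5 ^ m * binaryWeight (x + 2 ^ (ℓ - 1) - 1) := by
  induction m generalizing x with
  | zero =>
    refine le_trans (Finset.card_le_one.2 ?_) (by simpa using one_le_binaryWeight _)
    simp +contextual
  | succ m ih =>
    set V := Finset.univ.filter fun v : TreeNode 2 ℓ => subtreeStart v = x with hV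
    set F := fun y => Finset.univ.filter fun C : Finset (TreeNode 2 ℓ) =>
      IsCoverFrom y C ∧ C.card ≤ m with hF
    have hsub : (Finset.univ.filter fun C : Finset (TreeNode 2 ℓ) =>
        IsCoverFrom x C ∧ C.card ≤ m + 1) ⊆
        insert ∅ (V.biUnion fun v => (F (x + subtreeSize v)).image (insert v)) := by
      intro C hC
      obtain ⟨hC, hm⟩ := (Finset.mem_filter.1 hC).2
      rcases C.eq_empty_or_nonempty with rfl | hne
      · simp
      obtain ⟨v, hv, hstart, hcov⟩ := hC.exists_erase hne
      refine Finset.mem_insert_of_mem (Finset.mem_biUnion.2 ⟨v, by simp [hV, hstart],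
        Finset.mem_image.2 ⟨C.erase v, ?_, Finset.insert_erase hv⟩⟩)
      simp only [hF, Finset.mem_filter, Finset.mem_univ, true_and]
      refine ⟨hcov, ?_⟩
      rw [Finset.card_erase_of_mem hv]
      omega
    set n := 2 ^ (ℓ - 1) with hn
    have hnpos : 0 < n := Nat.two_pow_pos _
    have hsum : ∑ v ∈ V, binaryWeight (x + subtreeSize v + n - 1) ≤
        4 * binaryWeight (x + n - 1) := by
      refine le_trans ?_ ((Nat.le_add_right _ _).trans
        (sum_binaryWeight_add_two_pow_le (x + n - 1) ℓ))
      have hinj : Set.InjOn (fun v : TreeNode 2 ℓ => ℓ - 1 - (v.1 : ℕ)) V := by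
        rintro ⟨d, i⟩ hv ⟨e, j⟩ hw hde
        have hv' : subtreeStart ⟨d, i⟩ = x := by simpa [hV] using hv
        have hw' : subtreeStart ⟨e, j⟩ = x := by simpa [hV] using hw
        have hde' : d = e := by
          have := d.2
          have := e.2
          simp only at hde
          exact Fin.ext (by omega)
        subst hde'
        have : (i : ℕ) = j :=
          Nat.eq_of_mul_eq_mul_right (subtreeSize_pos ⟨d, i⟩) (hv'.trans hw'.symm)
        rw [Fin.ext this]
      calc _ = ∑ j ∈ V.image fun v : TreeNode 2 ℓ => ℓ - 1 - (v.1 : ℕ),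
            binaryWeight (x + n - 1 + 2 ^ j) := by
            rw [Finset.sum_image hinj]
            refine Finset.sum_congr rfl fun v _ => ?_
            change _ = binaryWeight (x + n - 1 + subtreeSize v)
            congr 1
            omega
        _ ≤ _ := by
            refine Finset.sum_le_sum_of_subset ?_
            intro j hj
            obtain ⟨v, hv, rfl⟩ := Finset.mem_image.1 hj
            have hvx : subtreeStart v = x := by simpa [hV] using hv
            have := v.1.2
            refine Finset.mem_filter.2 ⟨Finset.mem_range.2 (by omega), ?_⟩
            rw [show x + n - 1 + 1 = x + n by omega]
            refine dvd_add (hvx ▸ Dvd.intro_left _ rfl) (pow_dvd_pow 2 (by omega))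
    calc _ ≤ _ := Finset.card_le_card hsub
      _ ≤ _ := Finset.card_insert_le _ _
      _ ≤ ∑ v ∈ V, 5 ^ m * binaryWeight (x + subtreeSize v + n - 1) + 1 := by
        refine Nat.add_le_add_right (Finset.card_biUnion_le.trans
          (Finset.sum_le_sum fun v _ => Finset.card_image_le.trans (ih _))) 1
      _ ≤ 5 ^ m * (4 * binaryWeight (x + n - 1)) + 5 ^ m * binaryWeight (x + n - 1) := by
        rw [← Finset.mul_sum]
        exact Nat.add_le_add (Nat.mul_le_mul_left _ hsum)
          (Nat.mul_pos (by positivity) (one_le_binaryWeight _))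
      _ = _ := by ring

open Classical in
theorem card_rangeCovers_le (m : ℕ) :
    (Finset.univ.filter fun C : Finset (TreeNode 2 ℓ) =>
      (∃ x < 2 ^ (ℓ - 1), IsCoverFrom x C) ∧ C.card ≤ m).card ≤
      5 ^ m * (2 * (2 ^ (ℓ - 1)) ^ 2) := by
  set n := 2 ^ (ℓ - 1) with hn
  calc _ ≤ ((Finset.range n).biUnion fun x => Finset.univ.filter
        fun C : Finset (TreeNode 2 ℓ) => IsCoverFrom x C ∧ C.card ≤ m).card := by
        refine Finset.card_le_card fun C hC => ?_
        simp only [Finset.mem_filter, Finset.mem_univ, true_and] at hC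
        obtain ⟨⟨x, hx, hC⟩, hm⟩ := hC
        exact Finset.mem_biUnion.2 ⟨x, Finset.mem_range.2 hx, by simp [hC, hm]⟩
    _ ≤ ∑ _x ∈ Finset.range n, 5 ^ m * (2 * n) := by
        refine Finset.card_biUnion_le.trans (Finset.sum_le_sum fun x hx =>
          (card_coversFrom_le x m).trans (Nat.mul_le_mul_left _ ((binaryWeight_le _).trans ?_)))
        have := Finset.mem_range.1 hx
        omega
    _ = _ := by
        rw [Finset.sum_const, Finset.card_range, smul_eq_mul]
        ring

theorem isCoverFrom_of_biUnion_eq_Icc {a b : Fin (2 ^ (ℓ - 1))} {C : Finset (TreeNode 2 ℓ)}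
    (hdisj : ∀ v ∈ C, ∀ w ∈ C, v ≠ w → Disjoint (subtreeLeaves v) (subtreeLeaves w))
    (hC : C.biUnion subtreeLeaves = Finset.Icc a b) : IsCoverFrom a C := by
  refine ⟨hdisj, b + 1, fun u => ?_⟩
  rw [← Finset.mem_biUnion, hC, Finset.mem_Icc, Fin.le_def, Fin.le_def, Nat.lt_succ_iff]

end Covers

section Utility

variable {α δ : ℝ} {ℓ : ℕ}

/-- The simultaneous error bound of the hierarchical mechanism. -/
noncomputable def errorBound (α δ : ℝ) (ℓ : ℕ) : ℝ :=
  16 * (ℓ : ℝ) ^ ((3 : ℝ) / 2) * Real.log (2 * ((2 : ℝ) ^ (ℓ - 1)) ^ 2 / δ) / α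

theorem measureReal_treeNoise_sum_ge_errorBound (hα : 0 < α) (hℓ : 1 ≤ ℓ) (hδ : 0 < δ)
    {C : Finset (TreeNode 2 ℓ)} (hC : C.card ≤ 2 * ℓ) :
    (treeNoise 2 ℓ (ℓ / α)).real {ω | errorBound α δ ℓ ≤ |∑ v ∈ C, ω v|} ≤
      32 / 9 * (δ / (2 * ((2 : ℝ) ^ (ℓ - 1)) ^ 2)) ^ 8 := by
  have hℓ1 : (1 : ℝ) ≤ ℓ := by exact_mod_cast hℓ
  have hℓ0 : (0 : ℝ) < ℓ := by linarith
  have hb : 0 < (ℓ : ℝ) / α := by positivity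
  set r := Real.sqrt ℓ with hr
  have hr2 : r ^ 2 = ℓ := Real.sq_sqrt hℓ0.le
  have hr1 : 1 ≤ r := Real.one_le_sqrt.2 hℓ1
  have hr0 : 0 < r := by linarith
  set X : ℝ := 2 * ((2 : ℝ) ^ (ℓ - 1)) ^ 2 / δ with hX
  have hX0 : 0 < X := by positivity
  set t : ℝ := α / (2 * ℓ * r) with ht
  have htb : t * (ℓ / α) = 1 / (2 * r) := by
    rw [ht]
    field_simp
  have hpow : (ℓ : ℝ) ^ ((3 : ℝ) / 2) = ℓ * r := by
    rw [show (3 : ℝ) / 2 = 1 + 1 / 2 by norm_num, Real.rpow_add hℓ0, Real.rpow_one, hr,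
      Real.sqrt_eq_rpow]
  have htT : -t * errorBound α δ ℓ = Real.log (X⁻¹ ^ 8) := by
    rw [Real.log_pow, Real.log_inv, errorBound, hpow, ← hX, ht]
    push_cast
    field_simp
    ring
  have hmain := measureReal_pi_laplaceMeasure_sum_ge hb (t := t) (by positivity)
    (by rw [htb, div_lt_one (by positivity)]; linarith) C (errorBound α δ ℓ)
  have hsq : (t * (ℓ / α)) ^ 2 = 1 / (4 * ℓ) := by
    rw [htb, div_pow, mul_pow, hr2]
    norm_num
  have hq1 : 1 / (4 * (ℓ : ℝ)) ≤ 1 / 4 :=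
    one_div_le_one_div_of_le (by norm_num) (by linarith)
  have hq0 : 0 < 1 / (4 * (ℓ : ℝ)) := by positivity
  have hbern : 3 / 4 ≤ (1 - 1 / (4 * (ℓ : ℝ))) ^ ℓ := by
    have h := one_add_mul_le_pow (a := -(1 / (4 * (ℓ : ℝ)))) (by linarith) ℓ
    rw [← sub_eq_add_neg] at h
    refine le_trans (le_of_eq ?_) h
    field_simp
    norm_num
  have hvar : (1 - 1 / (4 * (ℓ : ℝ)))⁻¹ ^ C.card ≤ 16 / 9 := by
    calc _ ≤ (1 - 1 / (4 * (ℓ : ℝ)))⁻¹ ^ (2 * ℓ) :=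
          pow_le_pow_right₀ ((one_le_inv₀ (by linarith)).2 (by linarith)) hC
      _ = (((1 - 1 / (4 * (ℓ : ℝ))) ^ ℓ)⁻¹) ^ 2 := by rw [mul_comm 2 ℓ, pow_mul, inv_pow]
      _ ≤ ((3 / 4 : ℝ)⁻¹) ^ 2 := by gcongr
      _ = 16 / 9 := by norm_num
  rw [htT, Real.exp_log (by positivity), hsq, hX, inv_div] at hmain
  refine hmain.trans ?_
  have hnn : 0 ≤ (δ / (2 * ((2 : ℝ) ^ (ℓ - 1)) ^ 2)) ^ 8 := by positivity
  nlinarith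

theorem ofReal_one_sub_le_treeNoise_errorBound (hα : 0 < α) (hℓ : 1 ≤ ℓ) (hδ0 : 0 < δ)
    (hδ1 : δ < 1) :
    ENNReal.ofReal (1 - δ) ≤ treeNoise 2 ℓ ((ℓ : ℝ) / α)
      {ω | ∀ a b : Fin (2 ^ (ℓ - 1)), a ≤ b → ∀ C : Finset (TreeNode 2 ℓ),
        (∀ v ∈ C, ∀ w ∈ C, v ≠ w → Disjoint (subtreeLeaves v) (subtreeLeaves w)) →
        C.biUnion subtreeLeaves = Finset.Icc a b → C.card ≤ 2 * ℓ →
        |∑ v ∈ C, ω v| ≤ errorBound α δ ℓ} := by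
  classical
  have hℓ0 : (0 : ℝ) < ℓ := by exact_mod_cast hℓ
  have := isProbabilityMeasure_laplaceMeasure (b := (ℓ : ℝ) / α) (by positivity)
  have : IsProbabilityMeasure (treeNoise 2 ℓ ((ℓ : ℝ) / α)) := by
    unfold treeNoise
    infer_instance
  set μ := treeNoise 2 ℓ ((ℓ : ℝ) / α) with hμ
  set G : Set (TreeNode 2 ℓ → ℝ) := {ω | ∀ a b : Fin (2 ^ (ℓ - 1)), a ≤ b → _} with hG
  set 𝒞 := Finset.univ.filter fun C : Finset (TreeNode 2 ℓ) =>
    (∃ x < 2 ^ (ℓ - 1), IsCoverFrom x C) ∧ C.card ≤ 2 * ℓ with h𝒞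
  set B : Set (TreeNode 2 ℓ → ℝ) := ⋃ C ∈ 𝒞, {ω | errorBound α δ ℓ ≤ |∑ v ∈ C, ω v|} with hB
  set n : ℝ := (2 : ℝ) ^ (ℓ - 1) with hn
  have hn1 : 1 ≤ n := one_le_pow₀ one_le_two
  have hcover : Set.univ ⊆ G ∪ B := by
    intro ω _
    by_contra hω
    rw [Set.mem_union, not_or] at hω
    refine hω.1 fun a b _ C hdisj hC hcard => ?_
    by_contra hlt
    refine hω.2 (Set.mem_biUnion (x := C) ?_ (not_le.1 hlt).le)
    exact Finset.mem_coe.2 (Finset.mem_filter.2 ⟨Finset.mem_univ _,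
      ⟨a, a.2, isCoverFrom_of_biUnion_eq_Icc hdisj hC⟩, hcard⟩)
  have hcard : (𝒞.card : ℝ) ≤ 50 * n ^ 7 := by
    have h : (𝒞.card : ℝ) ≤ 5 ^ (2 * ℓ) * (2 * n ^ 2) := by
      have h := card_rangeCovers_le (ℓ := ℓ) (2 * ℓ)
      rw [hn]
      exact_mod_cast h
    have h5 : (5 : ℝ) ^ (2 * ℓ) ≤ 25 * n ^ 5 := by
      obtain ⟨k, rfl⟩ := Nat.exists_eq_add_of_le' hℓ
      rw [hn, Nat.add_sub_cancel, ← pow_mul, mul_comm k, pow_mul, pow_mul, pow_succ, mul_comm]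
      gcongr <;> norm_num
    nlinarith [sq_nonneg n]
  have hBle : μ.real B ≤ δ := by
    calc μ.real B ≤ ∑ C ∈ 𝒞, μ.real {ω | errorBound α δ ℓ ≤ |∑ v ∈ C, ω v|} :=
          measureReal_biUnion_finset_le _ _
      _ ≤ ∑ C ∈ 𝒞, 32 / 9 * (δ / (2 * n ^ 2)) ^ 8 := Finset.sum_le_sum fun C hC =>
          measureReal_treeNoise_sum_ge_errorBound hα hℓ hδ0 (Finset.mem_filter.1 hC).2.2
      _ = 𝒞.card * (32 / 9 * (δ / (2 * n ^ 2)) ^ 8) := by rw [Finset.sum_const, nsmul_eq_mul]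
      _ ≤ 50 * n ^ 7 * (32 / 9 * (δ / (2 * n ^ 2)) ^ 8) := by gcongr
      _ = 25 / 36 * (δ ^ 8 / n ^ 9) := by
        field_simp
        norm_num
      _ ≤ 1 * (δ / 1) := by
        gcongr
        · norm_num
        · exact pow_le_of_le_one hδ0.le hδ1.le (by norm_num)
        · exact one_le_pow₀ hn1
      _ = δ := by ring
  rw [ENNReal.ofReal_le_iff_le_toReal (measure_ne_top μ G)]
  have h1 : 1 ≤ μ.real G + μ.real B := by
    calc (1 : ℝ) = μ.real Set.univ := by simp
      _ ≤ μ.real (G ∪ B) := measureReal_mono hcover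
      _ ≤ _ := measureReal_union_le _ _
  change 1 - δ ≤ μ.real G
  linarith

end Utility

/-- **Simultaneous utility of the hierarchical mechanism (binary tree).**
Each node of the complete binary tree with `ℓ` levels (`n = 2^{ℓ−1}` leaves) receives
independent `Laplace(ℓ/α)` noise `ω v`, and each range query `[a,b]` is answered by
summing the noisy counts over at most `2ℓ` disjoint subtree roots covering `[a,b]`, so
its error is `Σ_{v ∈ C} ω v`.  Then with probability at least `1 − δ`, every range query
has absolute error at most `16·ℓ^{3/2}·ln(2n²/δ)/α`; in particular the mechanism is
`(ε, δ)`-useful for range queries on databases with `N ≥ 16·ℓ^{3/2}·ln(2n²/δ)/(αε)`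
records. -/
theorem hierarchical_mechanism_useful (α : ℝ) (hα : 0 < α) (ℓ : ℕ) (hℓ : 1 ≤ ℓ)
    (δ : ℝ) (hδ0 : 0 < δ) (hδ1 : δ < 1) :
    (ENNReal.ofReal (1 - δ)
      ≤ treeNoise 2 ℓ ((ℓ : ℝ) / α)
          {ω | ∀ a b : Fin (2 ^ (ℓ - 1)), a ≤ b →
            ∀ C : Finset (TreeNode 2 ℓ),
              (∀ v ∈ C, ∀ w ∈ C, v ≠ w → Disjoint (subtreeLeaves v) (subtreeLeaves w)) →
              C.biUnion subtreeLeaves = Finset.Icc a b →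
              C.card ≤ 2 * ℓ →
              |∑ v ∈ C, ω v|
                ≤ 16 * (ℓ : ℝ) ^ ((3 : ℝ) / 2)
                    * Real.log (2 * ((2 : ℝ) ^ (ℓ - 1)) ^ 2 / δ) / α})
    ∧ ∀ (ε N : ℝ), 0 < ε →
        16 * (ℓ : ℝ) ^ ((3 : ℝ) / 2) * Real.log (2 * ((2 : ℝ) ^ (ℓ - 1)) ^ 2 / δ) / (α * ε)
          ≤ N →
        ENNReal.ofReal (1 - δ)
          ≤ treeNoise 2 ℓ ((ℓ : ℝ) / α)
              {ω | ∀ a b : Fin (2 ^ (ℓ - 1)), a ≤ b →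
                ∀ C : Finset (TreeNode 2 ℓ),
                  (∀ v ∈ C, ∀ w ∈ C, v ≠ w → Disjoint (subtreeLeaves v) (subtreeLeaves w)) →
                  C.biUnion subtreeLeaves = Finset.Icc a b →
                  C.card ≤ 2 * ℓ →
                  |∑ v ∈ C, ω v| ≤ ε * N} := by
  refine ⟨ofReal_one_sub_le_treeNoise_errorBound hα hℓ hδ0 hδ1, fun ε N hε hN => ?_⟩
  refine (ofReal_one_sub_le_treeNoise_errorBound hα hℓ hδ0 hδ1).trans
    (measure_mono fun ω hω a b hab C hdisj hC hcard => (hω a b hab C hdisj hC hcard).trans ?_)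
  rw [← div_div, div_le_iff₀ hε, mul_comm N] at hN
  exact hN
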